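/- arXiv:1008.2447 — 5 statements merged into one kernel-verified Lean document; each statement's English description precedes it below -/
import Mathlib

section
/- Suppose that Z₁ and Z₂ are complete separable metric spaces, μ is a Borel probability measure on Z₁, and φ₁, φ₂, … is a sequence of Borel measurable functions from Z₁ to Z₂. Suppose further that, when z is a random variable distributed according to μ, the law of the pair (z, φᵢ(z)) (i.e., the pushforward of μ under z ↦ (z, φᵢ(z))) converges weakly as i → ∞ to the law of (z, φ(z)), where φ : Z₁ → Z₂ is Borel measurable. Then φᵢ converges to φ in probability: for every ε > 0, μ{ z ∈ Z₁ : d(φᵢ(z), φ(z)) > ε } → 0 as i → ∞, where d is the metric on Z₂. -/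
open MeasureTheory Filter Topology

/-- An integrable weight may be inserted in the first variable of the weak convergence of the
graph laws. -/
theorem tendsto_integral_mul_comp_of_weak_convergence_of_graphs
    {Z₁ Z₂ : Type*}
    [MetricSpace Z₁] [TopologicalSpace.SeparableSpace Z₁] [MeasurableSpace Z₁] [BorelSpace Z₁]
    [MetricSpace Z₂] [TopologicalSpace.SeparableSpace Z₂] [MeasurableSpace Z₂] [BorelSpace Z₂]
    (μ : Measure Z₁) [IsProbabilityMeasure μ]
    {φseq : ℕ → Z₁ → Z₂} (hφseq : ∀ i, Measurable (φseq i))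
    {φ : Z₁ → Z₂} (hφ : Measurable φ)
    (hconv : ∀ f : BoundedContinuousFunction (Z₁ × Z₂) ℝ,
      Tendsto (fun i => ∫ p, f p ∂(μ.map (fun z => (z, φseq i z))))
        atTop (𝓝 (∫ p, f p ∂(μ.map (fun z => (z, φ z))))))
    {w : Z₁ → ℝ} (hw : Integrable w μ) (g : BoundedContinuousFunction Z₂ ℝ) :
    Tendsto (fun i => ∫ z, w z * g (φseq i z) ∂μ) atTop (𝓝 (∫ z, w z * g (φ z) ∂μ)) := by
  have := UniformSpace.secondCountable_of_separable Z₁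
  have := UniformSpace.secondCountable_of_separable Z₂
  have hint : ∀ {v : Z₁ → ℝ} {ψ : Z₁ → Z₂}, Integrable v μ → Measurable ψ →
      Integrable (fun z => v z * g (ψ z)) μ := fun hv hψ =>
    hv.mul_bdd (c := ‖g‖) (g.continuous.measurable.comp hψ).aestronglyMeasurable
      (ae_of_all _ fun z => g.norm_coe_le_norm _)
  rw [Metric.tendsto_atTop]
  intro ε hε
  have hC : 0 < ‖g‖ + 1 := by positivity
  obtain ⟨h, hh, hhi⟩ := hw.exists_boundedContinuous_integral_sub_le
    (ε := ε / 3 / (‖g‖ + 1)) (by positivity)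
  have hlt : ε / 3 / (‖g‖ + 1) * ‖g‖ < ε / 3 := by
    rw [div_mul_eq_mul_div, div_lt_iff₀ hC]
    nlinarith
  have key : ∀ {ψ : Z₁ → Z₂}, Measurable ψ →
      |∫ z, w z * g (ψ z) ∂μ - ∫ z, h z * g (ψ z) ∂μ| < ε / 3 := by
    intro ψ hψ
    rw [← integral_sub (hint hw hψ) (hint hhi hψ)]
    refine lt_of_le_of_lt ?_ hlt
    calc |∫ z, w z * g (ψ z) - h z * g (ψ z) ∂μ|
        ≤ ∫ z, ‖w z - h z‖ * ‖g‖ ∂μ := by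
          rw [← Real.norm_eq_abs]
          refine norm_integral_le_of_norm_le ((hw.sub hhi).norm.mul_const _)
            (ae_of_all _ fun z => ?_)
          rw [← sub_mul, norm_mul]
          exact mul_le_mul_of_nonneg_left (g.norm_coe_le_norm _) (norm_nonneg _)
      _ ≤ ε / 3 / (‖g‖ + 1) * ‖g‖ := by
          rw [integral_mul_const]
          exact mul_le_mul_of_nonneg_right hh (norm_nonneg _)
  let F : BoundedContinuousFunction (Z₁ × Z₂) ℝ :=
    h.compContinuous ⟨Prod.fst, continuous_fst⟩ * g.compContinuous ⟨Prod.snd, continuous_snd⟩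
  have hF : ∀ {ψ : Z₁ → Z₂}, Measurable ψ →
      ∫ p, F p ∂(μ.map (fun z => (z, ψ z))) = ∫ z, h z * g (ψ z) ∂μ := by
    intro ψ hψ
    rw [integral_map (measurable_id'.prodMk hψ).aemeasurable
      F.continuous.measurable.aestronglyMeasurable]
    rfl
  have hc := hconv F
  simp only [hF (hφseq _), hF hφ] at hc
  obtain ⟨N, hN⟩ := Metric.tendsto_atTop.1 hc (ε / 3) (by positivity)
  refine ⟨N, fun n hn => ?_⟩
  have h1 := abs_lt.1 (key (hφseq n))
  have h2 := abs_lt.1 (key hφ)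
  have h3 := hN n hn
  rw [Real.dist_eq, abs_lt] at h3 ⊢
  constructor <;> linarith [h1.1, h1.2, h2.1, h2.2, h3.1, h3.2]

/-- If the laws of `(z, φᵢ(z))` under `μ` converge weakly to the law of `(z, φ(z))`, then
`φᵢ → φ` in probability (in `μ`-measure). -/
theorem tendstoInMeasure_of_weak_convergence_of_graphs
    {Z₁ Z₂ : Type*}
    [MetricSpace Z₁] [CompleteSpace Z₁] [TopologicalSpace.SeparableSpace Z₁]
    [MeasurableSpace Z₁] [BorelSpace Z₁]
    [MetricSpace Z₂] [CompleteSpace Z₂] [TopologicalSpace.SeparableSpace Z₂]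
    [MeasurableSpace Z₂] [BorelSpace Z₂]
    (μ : Measure Z₁) [IsProbabilityMeasure μ]
    (φseq : ℕ → Z₁ → Z₂) (hφseq : ∀ i, Measurable (φseq i))
    (φ : Z₁ → Z₂) (hφ : Measurable φ)
    (hconv : ∀ f : BoundedContinuousFunction (Z₁ × Z₂) ℝ,
      Tendsto (fun i => ∫ p, f p ∂(μ.map (fun z => (z, φseq i z))))
        atTop (𝓝 (∫ p, f p ∂(μ.map (fun z => (z, φ z)))))) :
    ∀ ε : ℝ, 0 < ε →
      Tendsto (fun i => μ {z | ε < dist (φseq i z) (φ z)}) atTop (𝓝 0) := by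
  intro ε hε
  have := UniformSpace.secondCountable_of_separable Z₂
  have : Nonempty Z₁ := μ.nonempty_of_neZero
  have : Nonempty Z₂ := this.map φ
  let y := TopologicalSpace.denseSeq Z₂
  let A : ℕ → Set Z₁ := disjointed fun k => φ ⁻¹' Metric.ball (y k) (ε / 4)
  have hA : ∀ k, MeasurableSet (A k) :=
    MeasurableSet.disjointed fun k => hφ Metric.isOpen_ball.measurableSet
  have hAdisj : Pairwise (Function.onFun Disjoint A) := disjoint_disjointed _
  have hAball : ∀ {k z}, z ∈ A k → dist (φ z) (y k) < ε / 4 :=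
    fun {k z} hz => disjointed_subset _ k hz
  have hAuniv : ⋃ k, A k = Set.univ := by
    rw [iUnion_disjointed, Set.eq_univ_iff_forall]
    intro z
    obtain ⟨k, hk⟩ := (TopologicalSpace.denseRange_denseSeq Z₂).exists_dist_lt (φ z)
      (show 0 < ε / 4 by positivity)
    exact Set.mem_iUnion.2 ⟨k, hk⟩
  let E : ℕ → Set Z₁ := fun i => {z | ε < dist (φseq i z) (φ z)}
  have hE : ∀ i, MeasurableSet (E i) := fun i =>
    measurableSet_lt measurable_const ((hφseq i).dist hφ)
  have hsum : ∀ {S : Set Z₁}, MeasurableSet S →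
      HasSum (fun k => μ.real (S ∩ A k)) (μ.real S) := by
    intro S hS
    have h : μ S = ∑' k, μ (S ∩ A k) := by
      rw [← measure_iUnion
        (fun i j hij => (hAdisj hij).mono Set.inter_subset_right Set.inter_subset_right)
        (fun k => hS.inter (hA k)), ← Set.inter_iUnion, hAuniv, Set.inter_univ]
    have hne : ∑' k, μ (S ∩ A k) ≠ ⊤ := h ▸ measure_ne_top μ S
    simpa only [Measure.real, h, ENNReal.tsum_toReal_eq (fun k => measure_ne_top μ (S ∩ A k))]
      using ENNReal.hasSum_toReal hne
  have hpiece : ∀ k, Tendsto (fun i => μ.real (E i ∩ A k)) atTop (𝓝 0) := by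
    intro k
    let g : BoundedContinuousFunction Z₂ ℝ := BoundedContinuousFunction.ofNormedAddCommGroup
      (fun x => min 1 (max 0 ((dist x (y k) - ε / 2) / (ε / 4)))) (by fun_prop) 1 (fun x => by
        rw [Real.norm_eq_abs, abs_of_nonneg (by positivity)]
        exact min_le_left _ _)
    have hg0 : ∀ x, 0 ≤ g x := fun x => le_min zero_le_one (le_max_left _ _)
    have hind : Integrable ((A k).indicator fun _ => (1 : ℝ)) μ :=
      (integrable_const _).indicator (hA k)
    have hlim := tendsto_integral_mul_comp_of_weak_convergence_of_graphs μ hφseq hφ hconv hind g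
    have hzero : ∫ z, (A k).indicator (fun _ => (1 : ℝ)) z * g (φ z) ∂μ = 0 := by
      refine integral_eq_zero_of_ae (ae_of_all _ fun z => ?_)
      by_cases hz : z ∈ A k
      · have hneg : (dist (φ z) (y k) - ε / 2) / (ε / 4) ≤ 0 :=
          div_nonpos_of_nonpos_of_nonneg (by linarith [hAball hz]) (by positivity)
        have : g (φ z) = 0 := by
          change min 1 (max 0 ((dist (φ z) (y k) - ε / 2) / (ε / 4))) = 0
          simp [max_eq_left hneg]
        simp [this]
      · simp [hz]
    rw [hzero] at hlim
    refine squeeze_zero (fun i => measureReal_nonneg) (fun i => ?_) hlim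
    rw [← integral_indicator_one ((hE i).inter (hA k))]
    refine integral_mono ((integrable_const _).indicator ((hE i).inter (hA k)))
      (hind.mul_bdd (c := ‖g‖) (g.continuous.measurable.comp (hφseq i)).aestronglyMeasurable
        (ae_of_all _ fun z => g.norm_coe_le_norm _)) fun z => ?_
    by_cases hz : z ∈ E i ∩ A k
    · have hzE : ε < dist (φseq i z) (φ z) := hz.1
      have htri := dist_triangle_right (φseq i z) (φ z) (y k)
      have : 1 ≤ g (φseq i z) := le_min le_rfl <| le_max_of_le_right <| by
        rw [one_le_div (by positivity)]
        linarith [hAball hz.2]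
      simpa [hz.1, hz.2] using this
    · rw [Set.indicator_of_notMem hz]
      exact mul_nonneg (Set.indicator_nonneg (fun _ _ => zero_le_one) _) (hg0 _)
  have hreal : Tendsto (fun i => μ.real (E i)) atTop (𝓝 0) := by
    have h := tendsto_tsum_of_dominated_convergence (𝓕 := atTop)
      (f := fun i k => μ.real (E i ∩ A k)) (g := fun _ => (0 : ℝ))
      (hsum MeasurableSet.univ).summable hpiece
      (Eventually.of_forall fun i k => by
        rw [Real.norm_eq_abs, abs_of_nonneg measureReal_nonneg]
        exact measureReal_mono (Set.inter_subset_inter_left _ (Set.subset_univ _)))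
    simpa only [(hsum (hE _)).tsum_eq, tsum_zero] using h
  exact (ENNReal.tendsto_toReal_iff (fun i => measure_ne_top μ _) ENNReal.zero_ne_top).1 hreal
end

section
/- Let X and Y be independent real-valued random variables on a probability space. Suppose the law of X is the Gaussian measure with mean m₁ and variance v₁ ≥ 0, and the law of X + Y is the Gaussian measure with mean m and variance v (where a Gaussian of variance 0 is the point mass at its mean). Then v ≥ v₁ and the law of Y is the Gaussian measure with mean m − m₁ and variance v − v₁. -/
open MeasureTheory ProbabilityTheory

/-- If `X` and `Y` are independent, `X` is Gaussian with mean `m₁` and variance `v₁`, and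
`X + Y` is Gaussian with mean `m` and variance `v`, then `v₁ ≤ v` and `Y` is Gaussian with
mean `m - m₁` and variance `v - v₁`. -/
theorem gaussian_of_indep_sum_gaussian
    {Ω : Type*} [MeasurableSpace Ω] (μ : Measure Ω) [IsProbabilityMeasure μ]
    (X Y : Ω → ℝ) (hX : Measurable X) (hY : Measurable Y)
    (hindep : IndepFun X Y μ)
    (m₁ m : ℝ) (v₁ v : NNReal)
    (hXlaw : μ.map X = gaussianReal m₁ v₁)
    (hXYlaw : μ.map (X + Y) = gaussianReal m v) :
    v₁ ≤ v ∧ μ.map Y = gaussianReal (m - m₁) (v - v₁) := by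
  have : IsProbabilityMeasure (μ.map Y) := Measure.isProbabilityMeasure_map hY.aemeasurable
  have hmul (t : ℝ) : Complex.exp (t * m * Complex.I - v * t ^ 2 / 2) =
      Complex.exp (t * m₁ * Complex.I - v₁ * t ^ 2 / 2) * charFun (μ.map Y) t := by
    have h := congrFun (hindep.charFun_map_add_eq_mul hX.aemeasurable hY.aemeasurable) t
    rwa [hXYlaw, Pi.mul_apply, hXlaw, charFun_gaussianReal, charFun_gaussianReal] at h
  have hle : v₁ ≤ v := by
    have h := congrArg norm (hmul 1)
    rw [norm_mul, Complex.norm_exp, Complex.norm_exp] at h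
    have hexp := h.trans_le
      (mul_le_of_le_one_right (Real.exp_pos _).le (norm_charFun_le_one (μ := μ.map Y) 1))
    rw [Real.exp_le_exp] at hexp
    simp at hexp
    rw [← NNReal.coe_le_coe]
    linarith
  refine ⟨hle, Measure.ext_of_charFun (funext fun t ↦ ?_)⟩
  refine mul_left_cancel₀ (Complex.exp_ne_zero (t * m₁ * Complex.I - v₁ * t ^ 2 / 2)) ?_
  rw [← hmul, charFun_gaussianReal, ← Complex.exp_add, NNReal.coe_sub hle]
  push_cast
  ring_nf
end

section
/- Conformal invariance of the Dirichlet inner product: let D, D' ⊆ ℂ be open sets and let φ : ℂ → ℂ be holomorphic and injective on D with φ(D) = D'. Let f₁, f₂ : ℂ → ℝ be continuously differentiable functions whose supports are compact subsets of D'. Then ∫_{D'} ⟨∇f₁(y), ∇f₂(y)⟩ dy = ∫_{D} ⟨∇(f₁ ∘ φ)(x), ∇(f₂ ∘ φ)(x)⟩ dx, where ∇ is the gradient for ℂ identified with ℝ² with its standard inner product, and the integrals are with respect to Lebesgue measure on ℂ ≅ ℝ². -/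
open MeasureTheory Complex

/-- The integrand `⟨∇f(x), ∇g(x)⟩` of the Dirichlet inner product, for `ℂ` identified with `ℝ²`
with its standard inner product (in which `1, I` form an orthonormal basis). -/
noncomputable def dirichletDensity (f g : ℂ → ℝ) (x : ℂ) : ℝ :=
  fderiv ℝ f x 1 * fderiv ℝ g x 1 + fderiv ℝ f x Complex.I * fderiv ℝ g x Complex.I

theorem Complex.det_smul_one_real (c : ℂ) :
    (c • (1 : ℂ →L[ℝ] ℂ)).det = normSq c := by
  rw [← Algebra.norm_complex_apply, Algebra.norm_apply]
  rfl

/-- The Dirichlet density of a pullback by a holomorphic map scales by the squared modulus of the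
derivative. -/
theorem dirichletDensity_comp {f g : ℂ → ℝ} {φ : ℂ → ℂ} {c z : ℂ}
    (hf : DifferentiableAt ℝ f (φ z)) (hg : DifferentiableAt ℝ g (φ z))
    (hφ : HasDerivAt φ c z) :
    dirichletDensity (f ∘ φ) (g ∘ φ) z = normSq c * dirichletDensity f g (φ z) := by
  have expand (L : ℂ →L[ℝ] ℝ) (w : ℂ) : L w = w.re * L 1 + w.im * L I := by
    conv_lhs => rw [← re_add_im w]
    rw [← mul_one (w.re : ℂ), ← real_smul, ← real_smul, map_add, map_smul, map_smul,
      smul_eq_mul, smul_eq_mul]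
  have hφ' := hφ.complexToReal_fderiv
  simp only [dirichletDensity, (hf.hasFDerivAt.comp z hφ').fderiv,
    (hg.hasFDerivAt.comp z hφ').fderiv, ContinuousLinearMap.comp_apply,
    smul_apply, one_apply_eq_self, smul_eq_mul, mul_one]
  rw [expand _ c, expand (fderiv ℝ g (φ z)) c, expand _ (c * I),
    expand (fderiv ℝ g (φ z)) (c * I), normSq_apply]
  simp only [mul_I_re, mul_I_im]
  ring

/-- Conformal invariance of the Dirichlet inner product: if `φ` is holomorphic and injective
on `D` with `φ(D) = D'`, and `f₁, f₂` are `C¹` functions compactly supported in `D'`, then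
`∫_{D'} ⟨∇f₁, ∇f₂⟩ = ∫_D ⟨∇(f₁ ∘ φ), ∇(f₂ ∘ φ)⟩`. -/
theorem dirichlet_inner_conformal_invariant
    (D D' : Set ℂ) (hD : IsOpen D) (hD' : IsOpen D')
    (φ : ℂ → ℂ) (hφ : ∀ z ∈ D, DifferentiableAt ℂ φ z)
    (hinj : Set.InjOn φ D) (himage : φ '' D = D')
    (f₁ f₂ : ℂ → ℝ)
    (hf₁ : ContDiff ℝ 1 f₁) (hf₂ : ContDiff ℝ 1 f₂)
    (hsupp₁ : HasCompactSupport f₁) (hsupp₂ : HasCompactSupport f₂)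
    (hsub₁ : tsupport f₁ ⊆ D') (hsub₂ : tsupport f₂ ⊆ D') :
    ∫ y in D', dirichletDensity f₁ f₂ y ∂volume
      = ∫ x in D, dirichletDensity (f₁ ∘ φ) (f₂ ∘ φ) x ∂volume := by
  subst himage
  have hderiv (z : ℂ) (hz : z ∈ D) := (hφ z hz).hasDerivAt
  rw [integral_image_eq_integral_abs_det_fderiv_smul volume hD.measurableSet
    (fun z hz ↦ (hderiv z hz).complexToReal_fderiv.hasFDerivWithinAt) hinj]
  refine setIntegral_congr_fun hD.measurableSet fun z hz ↦ ?_
  rw [det_smul_one_real, abs_of_nonneg (normSq_nonneg _), smul_eq_mul,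
    dirichletDensity_comp (hf₁.differentiable one_ne_zero _)
      (hf₂.differentiable one_ne_zero _) (hderiv z hz)]
end

section
/- Let V be a finite set, let X be a standard Borel space, and let (Ω, P) be a probability space whose underlying measurable space is standard Borel. Let h : Ω → (V → X) be measurable, and let A₁, A₂ be random subsets of V (measurable maps from Ω to the finite set of subsets of V). Call a random subset A of V local for h if for every fixed subset B ⊆ V, conditionally on the σ-algebra generated by the restriction of h to V ∖ B, the indicator of the event {A ∩ B = ∅} is independent of the restriction of h to B. Suppose A₁ and A₂ are each local for h and that A₁ and A₂ are conditionally independent of each other given the σ-algebra generated by h. Then the union A₁ ∪ A₂ is local for h. -/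
open MeasureTheory ProbabilityTheory

instance finsetMeasurableSpace (V : Type*) : MeasurableSpace (Finset V) := ⊤

/-- A random subset `A` of a finite set `V` is *local* for a random function `h : Ω → (V → X)`
if for every fixed `B ⊆ V`, conditionally on the σ-algebra generated by the restriction of `h`
to `V ∖ B`, the indicator of the event `{A ∩ B = ∅}` is independent of the restriction of `h`
to `B`. -/
def IsLocalSubset {Ω : Type*} [mΩ : MeasurableSpace Ω] [StandardBorelSpace Ω]
    {V : Type*} [Fintype V] [DecidableEq V]
    {X : Type*} [MeasurableSpace X] [StandardBorelSpace X]
    (P : Measure Ω) [IsProbabilityMeasure P]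
    (h : Ω → V → X) (hh : Measurable h) (A : Ω → Finset V) : Prop :=
  ∀ B : Finset V,
    CondIndepFun
      (MeasurableSpace.comap (fun ω => fun v : {v : V // v ∉ B} => h ω v.1) inferInstance)
      (Measurable.comap_le
        (measurable_pi_lambda _ (fun v => (measurable_pi_apply v.1).comp hh)))
      (fun ω => if A ω ∩ B = ∅ then (1 : ℝ) else 0)
      (fun ω => fun v : {v : V // v ∈ B} => h ω v.1) P

/-- If `f` and `g` are conditionally independent given `k`, then conditioning an event of `f` on
the pair `(k, g)` is the same as conditioning it on `k` alone. -/
lemma ProbabilityTheory.CondIndepFun.condExp_comap_prodMk_ae_eq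
    {Ω α β γ : Type*} {mΩ : MeasurableSpace Ω} [StandardBorelSpace Ω]
    [MeasurableSpace α] [StandardBorelSpace α] [Nonempty α]
    [MeasurableSpace β] [StandardBorelSpace β] [Nonempty β] [mγ : MeasurableSpace γ]
    {μ : Measure Ω} [IsFiniteMeasure μ] {f : Ω → α} {g : Ω → β} {k : Ω → γ}
    (hf : Measurable f) (hg : Measurable g) (hk : Measurable k)
    (hfg : CondIndepFun (mγ.comap k) hk.comap_le f g μ) {s : Set α} (hs : MeasurableSet s) :
    μ⟦f ⁻¹' s | MeasurableSpace.comap (fun ω ↦ (k ω, g ω)) inferInstance⟧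
      =ᵐ[μ] μ⟦f ⁻¹' s | mγ.comap k⟧ := by
  have hdistrib := ae_of_ae_map (hk.prodMk hg).aemeasurable
    ((condIndepFun_iff_condDistrib_prod_ae_eq_prodMkRight hf hg hk).mp hfg.symm)
  filter_upwards [hdistrib, condDistrib_ae_eq_condExp (μ := μ) (hk.prodMk hg) hf hs,
    condDistrib_ae_eq_condExp (μ := μ) hk hf hs] with ω hω hpair hsingle
  rw [← hpair, ← hsingle, hω, Kernel.prodMkRight_apply]

/-- If conditioning an event `s` on `m₁ ⊔ m₂` is the same as conditioning it on `m₁`, then `s` is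
conditionally independent of `m₂` given `m₁`. -/
lemma ProbabilityTheory.condIndep_generateFrom_singleton_of_condExp_sup_ae_eq
    {Ω : Type*} {m₁ m₂ mΩ : MeasurableSpace Ω} [StandardBorelSpace Ω]
    {μ : Measure Ω} [IsFiniteMeasure μ] (hm₁ : m₁ ≤ mΩ) (hm₂ : m₂ ≤ mΩ)
    {s : Set Ω} (hs : MeasurableSet s) (h_eq : μ⟦s | m₁ ⊔ m₂⟧ =ᵐ[μ] μ⟦s | m₁⟧) :
    CondIndep m₁ (MeasurableSpace.generateFrom {s}) m₂ hm₁ μ := by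
  have hsup : m₁ ⊔ m₂ ≤ mΩ := sup_le hm₁ hm₂
  refine CondIndepSets.condIndep
    (MeasurableSpace.generateFrom_le (by rintro _ rfl; exact hs)) hm₂
    (IsPiSystem.singleton s) (@MeasurableSpace.isPiSystem_measurableSet Ω m₂) rfl
    (@MeasurableSpace.generateFrom_measurableSet Ω m₂).symm ?_
  rw [condIndepSets_iff m₁ hm₁ {s} {t | MeasurableSet[m₂] t} (by rintro _ rfl; exact hs)
    (fun t ht ↦ hm₂ t ht)]
  rintro s t rfl ht
  have hint {u : Set Ω} (hu : MeasurableSet u) : Integrable (u.indicator fun _ ↦ (1 : ℝ)) μ :=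
    (integrable_const 1).indicator hu
  have hmul (f : Ω → ℝ) : t.indicator f = (t.indicator fun _ ↦ (1 : ℝ)) * f := by
    ext ω; by_cases hω : ω ∈ t <;> simp [hω]
  have hpull : μ⟦s ∩ t | m₁ ⊔ m₂⟧ =ᵐ[μ] t.indicator (μ⟦s | m₁⟧) := by
    have hst : ((s ∩ t).indicator fun _ ↦ (1 : ℝ)) = t.indicator (s.indicator fun _ ↦ 1) := by
      rw [Set.indicator_indicator, Set.inter_comm]
    rw [hst]
    refine (condExp_indicator (hint hs) ((le_sup_right : m₂ ≤ m₁ ⊔ m₂) t ht)).trans ?_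
    filter_upwards [h_eq] with ω hω
    simp only [Set.indicator, hω]
  calc μ⟦s ∩ t | m₁⟧
    _ =ᵐ[μ] μ[μ⟦s ∩ t | m₁ ⊔ m₂⟧ | m₁] := (condExp_condExp_of_le le_sup_left hsup).symm
    _ =ᵐ[μ] μ[(t.indicator fun _ ↦ (1 : ℝ)) * μ⟦s | m₁⟧ | m₁] := by
      rw [← hmul]; exact condExp_congr_ae hpull
    _ =ᵐ[μ] μ⟦t | m₁⟧ * μ⟦s | m₁⟧ := by
      refine condExp_mul_of_stronglyMeasurable_right stronglyMeasurable_condExp ?_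
        (hint (hm₂ t ht))
      rw [← hmul]
      exact integrable_condExp.indicator (hm₂ t ht)
    _ =ᵐ[μ] μ⟦s | m₁⟧ * μ⟦t | m₁⟧ := by rw [mul_comm]

/-- If the conditional expectation of `f` given a finer σ-algebra is a.e. equal to a function
measurable with respect to a coarser one, then it is also the conditional expectation given the
coarser one. -/
lemma MeasureTheory.condExp_ae_eq_of_condExp_ae_eq_stronglyMeasurable
    {Ω E : Type*} {m₁ m₂ mΩ : MeasurableSpace Ω} {μ : Measure Ω} [IsFiniteMeasure μ]
    [NormedAddCommGroup E] [NormedSpace ℝ E] [CompleteSpace E]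
    (h₁₂ : m₁ ≤ m₂) (h₂ : m₂ ≤ mΩ) {f F : Ω → E} (hF : StronglyMeasurable[m₁] F)
    (hfF : μ[f | m₂] =ᵐ[μ] F) : μ[f | m₂] =ᵐ[μ] μ[f | m₁] :=
  calc μ[f | m₂]
    _ =ᵐ[μ] F := hfF
    _ = μ[F | m₁] :=
      (condExp_of_stronglyMeasurable (h₁₂.trans h₂) hF (integrable_condExp.congr hfF)).symm
    _ =ᵐ[μ] μ[μ[f | m₂] | m₁] := condExp_congr_ae hfF.symm
    _ =ᵐ[μ] μ[f | m₁] := condExp_condExp_of_le h₁₂ h₂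

/-- The σ-algebra generated by a random function is generated by its restrictions to a set of
indices and to the complement. -/
lemma MeasurableSpace.comap_pi_eq_comap_restrict_sup {Ω ι : Type*} {X : ι → Type*}
    [∀ i, MeasurableSpace (X i)] (h : Ω → ∀ i, X i) (p : ι → Prop) :
    MeasurableSpace.comap h inferInstance =
      MeasurableSpace.comap (fun ω ↦ fun i : {i // ¬ p i} ↦ h ω i.1) inferInstance ⊔
        MeasurableSpace.comap (fun ω ↦ fun i : {i // p i} ↦ h ω i.1) inferInstance := by
  apply le_antisymm
  · refine Measurable.comap_le (@measurable_pi_lambda _ _ _ (_) _ _ fun i ↦ ?_)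
    by_cases hi : p i
    · exact ((measurable_pi_apply (⟨i, hi⟩ : {i // p i})).comp
        (comap_measurable fun ω ↦ fun i : {i // p i} ↦ h ω i.1)).mono le_sup_right le_rfl
    · exact ((measurable_pi_apply (⟨i, hi⟩ : {i // ¬ p i})).comp
        (comap_measurable fun ω ↦ fun i : {i // ¬ p i} ↦ h ω i.1)).mono le_sup_left le_rfl
  · refine sup_le ?_ ?_ <;>
    · refine Measurable.comap_le (@measurable_pi_lambda _ _ _ (_) _ _ fun i ↦ ?_)
      exact (measurable_pi_apply i.1).comp (comap_measurable h)

/-- The event that a local subset avoids `B` has the same conditional probability given `h` as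
given the restriction of `h` to the complement of `B`. -/
lemma IsLocalSubset.condExp_inter_eq_empty_ae_eq
    {Ω : Type*} [mΩ : MeasurableSpace Ω] [StandardBorelSpace Ω]
    {V : Type*} [Fintype V] [DecidableEq V]
    {X : Type*} [MeasurableSpace X] [StandardBorelSpace X]
    {P : Measure Ω} [IsProbabilityMeasure P]
    {h : Ω → V → X} {hh : Measurable h} {A : Ω → Finset V} (hA : IsLocalSubset P h hh A)
    (hAm : Measurable A) (B : Finset V) :
    P⟦A ⁻¹' {a | a ∩ B = ∅} | MeasurableSpace.comap h inferInstance⟧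
      =ᵐ[P] P⟦A ⁻¹' {a | a ∩ B = ∅} |
        MeasurableSpace.comap (fun ω ↦ fun v : {v : V // v ∉ B} ↦ h ω v.1) inferInstance⟧ := by
  obtain ⟨ω₀⟩ : Nonempty Ω := nonempty_of_isProbabilityMeasure P
  have : Nonempty ({v : V // v ∈ B} → X) := ⟨fun v ↦ h ω₀ v.1⟩
  have hf : Measurable fun ω ↦ if A ω ∩ B = ∅ then (1 : ℝ) else 0 :=
    (measurable_from_top (f := fun a : Finset V ↦ if a ∩ B = ∅ then (1 : ℝ) else 0)).comp hAm
  have key := (hA B).condExp_comap_prodMk_ae_eq hf (by fun_prop) (by fun_prop)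
    (measurableSet_singleton 1)
  have hpre : (fun ω ↦ if A ω ∩ B = ∅ then (1 : ℝ) else 0) ⁻¹' {1} =
      A ⁻¹' {a | a ∩ B = ∅} := by
    ext ω; simp
  rw [hpre] at key
  rw [MeasurableSpace.comap_pi_eq_comap_restrict_sup h (· ∈ B), ← MeasurableSpace.comap_prodMk]
  exact key

/-- If `A₁` and `A₂` are local subsets for `h` which are conditionally independent given the
σ-algebra generated by `h`, then `A₁ ∪ A₂` is local for `h`. -/
theorem isLocalSubset_union
    {Ω : Type*} [mΩ : MeasurableSpace Ω] [StandardBorelSpace Ω]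
    {V : Type*} [Fintype V] [DecidableEq V]
    {X : Type*} [MeasurableSpace X] [StandardBorelSpace X]
    (P : Measure Ω) [IsProbabilityMeasure P]
    (h : Ω → V → X) (hh : Measurable h)
    (A₁ A₂ : Ω → Finset V) (hA₁m : Measurable A₁) (hA₂m : Measurable A₂)
    (hA₁ : IsLocalSubset P h hh A₁) (hA₂ : IsLocalSubset P h hh A₂)
    (hci : CondIndepFun (MeasurableSpace.comap h inferInstance)
      (Measurable.comap_le hh) A₁ A₂ P) :
    IsLocalSubset P h hh (fun ω => A₁ ω ∪ A₂ ω) := by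
  intro B
  have hm_out : Measurable fun ω ↦ fun v : {v : V // v ∉ B} ↦ h ω v.1 := by fun_prop
  have hm_in : Measurable fun ω ↦ fun v : {v : V // v ∈ B} ↦ h ω v.1 := by fun_prop
  have hsup := MeasurableSpace.comap_pi_eq_comap_restrict_sup h (· ∈ B)
  have hE : MeasurableSet {a : Finset V | a ∩ B = ∅} := MeasurableSpace.measurableSet_top
  have hunion : {ω | (A₁ ω ∪ A₂ ω) ∩ B = ∅} =
      A₁ ⁻¹' {a | a ∩ B = ∅} ∩ A₂ ⁻¹' {a | a ∩ B = ∅} := by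
    ext ω
    simp [Finset.union_inter_distrib_right, Finset.union_eq_empty]
  have hEm : MeasurableSet {ω | (A₁ ω ∪ A₂ ω) ∩ B = ∅} := by
    rw [hunion]
    exact (hA₁m hE).inter (hA₂m hE)
  have hcond := (condIndepFun_iff_condExp_inter_preimage_eq_mul hA₁m hA₂m).mp hci _ _ hE hE
  rw [← hunion] at hcond
  have hprod := hcond.trans ((hA₁.condExp_inter_eq_empty_ae_eq hA₁m B).mul
    (hA₂.condExp_inter_eq_empty_ae_eq hA₂m B))
  have heq := condExp_ae_eq_of_condExp_ae_eq_stronglyMeasurable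
    (le_sup_left.trans_eq hsup.symm) hh.comap_le
    (stronglyMeasurable_condExp.mul stronglyMeasurable_condExp) hprod
  rw [hsup] at heq
  rw [condIndepFun_iff_condIndep]
  refine condIndep_of_condIndep_of_le_left
    (condIndep_generateFrom_singleton_of_condExp_sup_ae_eq hm_out.comap_le hm_in.comap_le hEm heq) ?_
  exact Measurable.comap_le (Measurable.ite
    (MeasurableSpace.measurableSet_generateFrom rfl) measurable_const measurable_const)
end

section
/- Let (Ω, P) be a probability space whose underlying measurable space is standard Borel, and let h, V, W be random variables on Ω taking values in standard Borel spaces E₁, E₂, E₃ respectively. Suppose that (i) W and V are conditionally independent given the σ-algebra generated by h, and (ii) there is a measurable function F : E₁ × E₂ → E₃ such that W = F(h, V) almost surely. Then there exists a measurable function G : E₁ → E₃ such that W = G(h) almost surely; that is, conditioned on h, the law of W is almost surely supported on a single point. -/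
open MeasureTheory ProbabilityTheory

/-- If the conditional distribution of `Y` given `X` is almost surely the Dirac mass at `Y`, then
`Y` is almost surely a measurable function of `X`. -/
theorem exists_measurable_ae_eq_comp_of_condDistrib_ae_eq_dirac
    {α β γ : Type*} [MeasurableSpace α] [MeasurableSpace β] [MeasurableSpace γ]
    [StandardBorelSpace γ] [Nonempty γ] {μ : Measure α} [IsFiniteMeasure μ]
    {X : α → β} {Y : α → γ}
    (hXY : ∀ᵐ a ∂μ, condDistrib Y X μ (X a) = Measure.dirac (Y a)) :
    ∃ G : β → γ, Measurable G ∧ Y =ᵐ[μ] fun a => G (X a) := by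
  have he := measurableEmbedding_embeddingReal γ
  obtain ⟨r, hr, hre⟩ := he.exists_measurable_extend measurable_id fun _ => ‹Nonempty γ›
  refine ⟨fun x => r (∫ y, embeddingReal γ y ∂condDistrib Y X μ x),
    hr.comp (he.measurable.stronglyMeasurable.integral_kernel).measurable, ?_⟩
  filter_upwards [hXY] with a ha
  rw [ha, integral_dirac]
  exact (congrFun hre (Y a)).symm

/-- If `W` and `V` are conditionally independent given `σ(h)` and `W = F(h, V)` almost surely
for some measurable `F`, then `W` is almost surely a measurable function of `h` alone. -/
theorem measurable_function_of_h_of_condIndep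
    {Ω : Type*} [mΩ : MeasurableSpace Ω] [StandardBorelSpace Ω]
    (P : Measure Ω) [IsProbabilityMeasure P]
    {E₁ E₂ E₃ : Type*}
    [MeasurableSpace E₁] [StandardBorelSpace E₁]
    [MeasurableSpace E₂] [StandardBorelSpace E₂]
    [MeasurableSpace E₃] [StandardBorelSpace E₃]
    (h : Ω → E₁) (V : Ω → E₂) (W : Ω → E₃)
    (hh : Measurable h) (hV : Measurable V) (hW : Measurable W)
    (hci : CondIndepFun (MeasurableSpace.comap h inferInstance)
      (Measurable.comap_le hh) W V P)
    (F : E₁ × E₂ → E₃) (hF : Measurable F)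
    (hWF : W =ᵐ[P] fun ω => F (h ω, V ω)) :
    ∃ G : E₁ → E₃, Measurable G ∧ W =ᵐ[P] fun ω => G (h ω) := by
  have : Nonempty Ω := P.nonempty_of_neZero
  have : Nonempty E₂ := this.map V
  have : Nonempty E₃ := ‹Nonempty Ω›.map W
  have hVW := (condIndepFun_iff_condDistrib_prod_ae_eq_prodMkRight hW hV hh).1 hci.symm
  have hdet := condDistrib_comp_self (μ := P) (fun ω => (h ω, V ω)) hF
  rw [condDistrib_congr_left hWF] at hVW
  have hpair := ae_of_ae_map (hh.prodMk hV).aemeasurable (hVW.symm.trans hdet)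
  refine exists_measurable_ae_eq_comp_of_condDistrib_ae_eq_dirac ?_
  filter_upwards [hpair, hWF] with ω hω hWω
  rw [Kernel.prodMkRight_apply, Kernel.deterministic_apply] at hω
  rw [hWω]
  simpa only [condDistrib_congr_left hWF] using hω
end
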